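/- Let A be a finite-dimensional algebra over a finite field and let X, Y, Z be finite-dimensional right A-modules with X = X' ⊕ I, where I is an injective A-module. Then F^Y_{X,Z} is nonzero if and only if Y ≅ Y' ⊕ I for some A-module Y' with F^{Y'}_{X',Z} nonzero; and in this case F^Y_{X,Z} = (|Mon_A(I,Y)| / |Mon_A(I,X)|) · F^{Y'}_{X',Z}. -/

import Mathlib

noncomputable section

namespace BirkhoffMod

/-- The Hall number `F^Y_{X,Z}`: the number of submodules `U ⊆ Y` with `U ≅ X` and
`Y/U ≅ Z`. -/
def hallPair (A : Type) [Ring A] (X Z Y : Type)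
    [AddCommGroup X] [Module A X] [AddCommGroup Z] [Module A Z]
    [AddCommGroup Y] [Module A Y] : ℕ :=
  Nat.card {U : Submodule A Y //
    Nonempty (U ≃ₗ[A] X) ∧ Nonempty ((Y ⧸ U) ≃ₗ[A] Z)}

/-- The Hall number `F^Y_{X₁,X₂,X₃}`: the number of chains `0 ⊆ U₁ ⊆ U₂ ⊆ Y` with
`U₁ ≅ X₁`, `U₂/U₁ ≅ X₂` and `Y/U₂ ≅ X₃`. -/
def hallTriple (A : Type) [Ring A] (X₁ X₂ X₃ Y : Type)
    [AddCommGroup X₁] [Module A X₁] [AddCommGroup X₂] [Module A X₂]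
    [AddCommGroup X₃] [Module A X₃] [AddCommGroup Y] [Module A Y] : ℕ :=
  Nat.card {p : Submodule A Y × Submodule A Y //
    p.1 ≤ p.2 ∧ Nonempty (p.1 ≃ₗ[A] X₁) ∧
    Nonempty ((↥p.2 ⧸ (p.1.comap p.2.subtype)) ≃ₗ[A] X₂) ∧
    Nonempty ((Y ⧸ p.2) ≃ₗ[A] X₃)}

/-- The Hall number `F^Y_{X_1,…,X_t}`: the number of chains of submodules
`0 = U_0 ⊆ U_1 ⊆ … ⊆ U_t = Y` with `U_i/U_{i-1} ≅ X_i` for all `i`. -/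
def hallChain (A : Type) [Ring A] {t : ℕ} (X : Fin t → Type)
    [∀ i, AddCommGroup (X i)] [∀ i, Module A (X i)]
    (Y : Type) [AddCommGroup Y] [Module A Y] : ℕ :=
  Nat.card {U : Fin (t + 1) → Submodule A Y //
    Monotone U ∧ U 0 = ⊥ ∧ U (Fin.last t) = ⊤ ∧
    ∀ i : Fin t,
      Nonempty ((↥(U i.succ) ⧸ ((U i.castSucc).comap (U i.succ).subtype)) ≃ₗ[A] X i)}

/-- The number of injective `A`-module homomorphisms `M → N`, i.e. `|Mon_A(M,N)|`. -/
def monCount (A : Type) [Ring A] (M N : Type)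
    [AddCommGroup M] [Module A M] [AddCommGroup N] [Module A N] : ℕ :=
  Nat.card {f : M →ₗ[A] N // Function.Injective f}

section Nilpotent

variable (k : Type) [Field k]

/-- The shift operator on `Fin m → k`, modelling multiplication by `x` on
`k[x]/(x^m)` in the basis `1, x, …, x^{m-1}`. -/
def shiftL (m : ℕ) : (Fin m → k) →ₗ[k] (Fin m → k) where
  toFun v i :=
    if h : 0 < (i : ℕ) then v ⟨(i : ℕ) - 1, lt_of_le_of_lt (Nat.sub_le _ _) i.isLt⟩ else 0
  map_add' u v := by
    funext i
    by_cases h : 0 < (i : ℕ) <;> simp [h]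
  map_smul' c v := by
    funext i
    by_cases h : 0 < (i : ℕ) <;> simp [h]

/-- Componentwise linear map between pi types. -/
def piMapL {ι : Type} {M N : ι → Type} [∀ i, AddCommGroup (M i)] [∀ i, Module k (M i)]
    [∀ i, AddCommGroup (N i)] [∀ i, Module k (N i)] (g : ∀ i, M i →ₗ[k] N i) :
    (∀ i, M i) →ₗ[k] (∀ i, N i) :=
  LinearMap.pi (fun i => (g i).comp (LinearMap.proj i))

/-- The nilpotent `k[x]`-module `N_λ(k) = ⊕ᵢ k[x]/(x^{λᵢ})` attached to a partition given
as a list `l = (λ₁, …, λ_s)`; `x` acts by the shift on each summand. -/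
def NRep (l : List ℕ) : Type :=
  Module.AEval' (piMapL k (fun i : Fin l.length => shiftL k (l.get i)))

instance (l : List ℕ) : AddCommGroup (NRep k l) := by
  unfold NRep; infer_instance

instance (l : List ℕ) : Module (Polynomial k) (NRep k l) := by
  unfold NRep; infer_instance

end Nilpotent

end BirkhoffMod

namespace BirkhoffMod

section

variable {A : Type} [Ring A]

section Cancellation

variable {L M N P : Type} [AddCommGroup L] [Module A L] [AddCommGroup M] [Module A M]
  [AddCommGroup N] [Module A N] [AddCommGroup P] [Module A P]

theorem finite_linearMap [Finite M] [Finite N] : Finite (M →ₗ[A] N) :=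
  Finite.of_injective (fun f => (f : M → N)) DFunLike.coe_injective

theorem finite_quotient [Finite L] (K : Submodule A L) : Finite (L ⧸ K) :=
  Finite.of_surjective _ K.mkQ_surjective

/-- Homomorphisms with kernel `K` are the injective homomorphisms out of the quotient by `K`. -/
def kerEqEquiv (K : Submodule A L) :
    {f : L →ₗ[A] M // LinearMap.ker f = K} ≃ {g : (L ⧸ K) →ₗ[A] M // Function.Injective g} where
  toFun f := ⟨K.liftQ f.1 f.2.ge, by
    rw [← LinearMap.ker_eq_bot, Submodule.ker_liftQ_eq_bot _ _ _ f.2.le]⟩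
  invFun g := ⟨g.1.comp K.mkQ, by
    rw [LinearMap.ker_comp, LinearMap.ker_eq_bot.2 g.2, Submodule.comap_bot, Submodule.ker_mkQ]⟩
  left_inv f := by ext; simp
  right_inv g := by ext; simp

theorem card_linearMap_eq_sum [Finite L] [Finite M] [Fintype (Submodule A L)] :
    Nat.card (L →ₗ[A] M) = ∑ K : Submodule A L, monCount A (L ⧸ K) M := by
  have : Finite (L →ₗ[A] M) := finite_linearMap
  rw [← Nat.card_congr (Equiv.sigmaFiberEquiv (fun f : L →ₗ[A] M => LinearMap.ker f)),
    Nat.card_sigma]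
  exact Finset.sum_congr rfl fun K _ => Nat.card_congr (kerEqEquiv K)

theorem monCount_congr_left (e : L ≃ₗ[A] P) : monCount A L M = monCount A P M :=
  Nat.card_congr
    { toFun f := ⟨f.1.comp e.symm.toLinearMap, f.2.comp e.symm.injective⟩
      invFun f := ⟨f.1.comp e.toLinearMap, f.2.comp e.injective⟩
      left_inv f := by ext; simp
      right_inv f := by ext; simp }

theorem monCount_congr_right (e : M ≃ₗ[A] N) : monCount A L M = monCount A L N :=
  Nat.card_congr
    { toFun f := ⟨e.toLinearMap.comp f.1, e.injective.comp f.2⟩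
      invFun f := ⟨e.symm.toLinearMap.comp f.1, e.symm.injective.comp f.2⟩
      left_inv f := by ext; simp
      right_inv f := by ext; simp }

/-- The numbers of homomorphisms into a finite module determine the numbers of injective
homomorphisms. -/
theorem monCount_eq_of_card_linearMap_eq [Finite M] [Finite N]
    (h : ∀ (L : Type) [AddCommGroup L] [Module A L] [Finite L],
      Nat.card (L →ₗ[A] M) = Nat.card (L →ₗ[A] N)) (n : ℕ) :
    ∀ (L : Type) [AddCommGroup L] [Module A L] [Finite L], Nat.card L = n →
      monCount A L M = monCount A L N := by
  classical
  induction n using Nat.strong_induction_on with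
  | _ n ih =>
    intro L _ _ _ hL
    have : Finite (Submodule A L) :=
      Finite.of_injective (fun K => (K : Set L)) SetLike.coe_injective
    have : Fintype (Submodule A L) := Fintype.ofFinite _
    have hsum := h L
    rw [card_linearMap_eq_sum, card_linearMap_eq_sum, Fintype.sum_eq_add_sum_compl ⊥,
      Fintype.sum_eq_add_sum_compl ⊥] at hsum
    have hrest : ∑ K ∈ ({⊥}ᶜ : Finset (Submodule A L)), monCount A (L ⧸ K) M =
        ∑ K ∈ ({⊥}ᶜ : Finset (Submodule A L)), monCount A (L ⧸ K) N := by
      refine Finset.sum_congr rfl fun K hK => ?_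
      have hK' : K ≠ ⊥ := by simpa using hK
      have : Finite (L ⧸ K) := finite_quotient K
      refine ih (Nat.card (L ⧸ K)) ?_ (L ⧸ K) rfl
      rw [← hL, Submodule.card_eq_card_quotient_mul_card K]
      have : Nontrivial K := Submodule.nontrivial_iff_ne_bot.2 hK'
      have h1 : 1 < Nat.card K := Finite.one_lt_card
      have h2 : 0 < Nat.card (L ⧸ K) := Nat.card_pos
      nlinarith
    rw [hrest] at hsum
    have e := Submodule.quotEquivOfEqBot (⊥ : Submodule A L) rfl
    rw [← monCount_congr_left e, ← monCount_congr_left e]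
    exact Nat.add_right_cancel hsum

theorem nonempty_linearEquiv_of_card_linearMap_eq [Finite M] [Finite N]
    (h : ∀ (L : Type) [AddCommGroup L] [Module A L] [Finite L],
      Nat.card (L →ₗ[A] M) = Nat.card (L →ₗ[A] N)) : Nonempty (M ≃ₗ[A] N) := by
  have : Finite (M →ₗ[A] M) := finite_linearMap
  have : Finite (N →ₗ[A] N) := finite_linearMap
  have hM : 0 < monCount A M M :=
    have : Nonempty {f : M →ₗ[A] M // Function.Injective f} :=
      ⟨⟨LinearMap.id, Function.injective_id⟩⟩
    Nat.card_pos
  have hN : 0 < monCount A N N :=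
    have : Nonempty {f : N →ₗ[A] N // Function.Injective f} :=
      ⟨⟨LinearMap.id, Function.injective_id⟩⟩
    Nat.card_pos
  rw [monCount_eq_of_card_linearMap_eq h _ M rfl] at hM
  rw [← monCount_eq_of_card_linearMap_eq h _ N rfl] at hN
  obtain ⟨⟨f, hf⟩⟩ := (Nat.card_pos_iff.1 hM).1
  obtain ⟨⟨g, hg⟩⟩ := (Nat.card_pos_iff.1 hN).1
  have hcard : Nat.card M = Nat.card N :=
    le_antisymm (Nat.card_le_card_of_injective f hf) (Nat.card_le_card_of_injective g hg)
  exact ⟨LinearEquiv.ofBijective f (hf.bijective_of_nat_card_le hcard.ge)⟩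

theorem card_linearMap_prod [Finite L] [Finite M] [Finite N] :
    Nat.card (L →ₗ[A] M × N) = Nat.card (L →ₗ[A] M) * Nat.card (L →ₗ[A] N) := by
  rw [← Nat.card_prod]
  exact Nat.card_congr (LinearMap.prodEquiv ℕ).symm.toEquiv

/-- Direct sum cancellation for finite modules. -/
theorem nonempty_linearEquiv_of_prod [Finite M] [Finite N] [Finite P]
    (e : (M × P) ≃ₗ[A] (N × P)) : Nonempty (M ≃ₗ[A] N) := by
  refine nonempty_linearEquiv_of_card_linearMap_eq fun L _ _ _ => ?_
  have : Finite (L →ₗ[A] P) := finite_linearMap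
  have h : Nat.card (L →ₗ[A] M × P) = Nat.card (L →ₗ[A] N × P) :=
    Nat.card_congr
      { toFun f := e.toLinearMap.comp f
        invFun f := e.symm.toLinearMap.comp f
        left_inv f := by ext x <;> simp
        right_inv f := by ext x <;> simp }
  rw [card_linearMap_prod, card_linearMap_prod] at h
  exact Nat.eq_of_mul_eq_mul_right Nat.card_pos h

theorem nonempty_linearEquiv_prod_iff [Finite M] [Finite N] [Finite P] :
    Nonempty ((M × P) ≃ₗ[A] (N × P)) ↔ Nonempty (M ≃ₗ[A] N) :=
  ⟨fun ⟨e⟩ => nonempty_linearEquiv_of_prod e, fun ⟨e⟩ => ⟨e.prodCongr (LinearEquiv.refl A P)⟩⟩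

end Cancellation

section Splitting

variable {I M W X X' Y Y' Z : Type} [AddCommGroup I] [Module A I] [AddCommGroup M] [Module A M]
  [AddCommGroup W] [Module A W] [AddCommGroup X] [Module A X] [AddCommGroup X'] [Module A X']
  [AddCommGroup Y] [Module A Y] [AddCommGroup Y'] [Module A Y'] [AddCommGroup Z] [Module A Z]

/-- A short exact sequence starting in an injective module splits. -/
theorem nonempty_linearEquiv_prod_of_injective (hI : Module.Injective A I) (f : I →ₗ[A] M)
    (hf : Function.Injective f) (g : M →ₗ[A] W) (hg : Function.Surjective g)
    (hfg : LinearMap.range f = LinearMap.ker g) : Nonempty (M ≃ₗ[A] W × I) := by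
  obtain ⟨r, hr⟩ := hI.out f hf LinearMap.id
  have hgf : ∀ i, g (f i) = 0 := fun i => by
    rw [← LinearMap.mem_ker, ← hfg]
    exact LinearMap.mem_range_self f i
  refine ⟨LinearEquiv.ofBijective (g.prod r) ⟨?_, ?_⟩⟩
  · rw [injective_iff_map_eq_zero]
    intro m hm
    obtain ⟨h1, h2⟩ := Prod.mk.inj hm
    obtain ⟨i, rfl⟩ : m ∈ LinearMap.range f := hfg ▸ LinearMap.mem_ker.2 h1
    have hi : i = 0 := by simpa [hr] using h2
    rw [hi, map_zero]
  · rintro ⟨w, i⟩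
    obtain ⟨m, rfl⟩ := hg w
    refine ⟨m + f (i - r m), ?_⟩
    ext <;> simp [hgf, hr]

/-- Quotients by preimages agree with iterated quotients. -/
theorem nonempty_quotient_comap_mkQ (K : Submodule A Y) (W : Submodule A (Y ⧸ K)) :
    Nonempty ((Y ⧸ W.comap K.mkQ) ≃ₗ[A] ((Y ⧸ K) ⧸ W)) := by
  have hker : LinearMap.ker (W.mkQ.comp K.mkQ) = W.comap K.mkQ := by
    rw [LinearMap.ker_comp, Submodule.ker_mkQ]
  exact ⟨(Submodule.quotEquivOfEq _ _ hker.symm).trans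
    (LinearMap.quotKerEquivOfSurjective _
      ((Submodule.mkQ_surjective W).comp (Submodule.mkQ_surjective K)))⟩

/-- The preimage in `Y` of a submodule of the cokernel of `f : I → Y` splits off `I`. -/
theorem nonempty_comap_mkQ_equiv_prod (hI : Module.Injective A I) (f : I →ₗ[A] Y)
    (hf : Function.Injective f) (W : Submodule A (Y ⧸ LinearMap.range f)) :
    Nonempty (W.comap (LinearMap.range f).mkQ ≃ₗ[A] W × I) := by
  have hmem : ∀ i, f i ∈ W.comap (LinearMap.range f).mkQ := fun i => by
    have h0 : (LinearMap.range f).mkQ (f i) = 0 := by simp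
    rw [Submodule.mem_comap, h0]
    exact W.zero_mem
  refine nonempty_linearEquiv_prod_of_injective hI (f.codRestrict _ hmem)
    (fun a b h => hf (congrArg Subtype.val h))
    ((LinearMap.range f).mkQ.restrict fun x hx => hx) ?_ ?_
  · rintro ⟨w, hw⟩
    obtain ⟨y, rfl⟩ := Submodule.mkQ_surjective _ w
    exact ⟨⟨y, hw⟩, rfl⟩
  · ext ⟨y, hy⟩
    simp [LinearMap.restrict_apply, Subtype.ext_iff]

theorem card_submodule_ge_range (hI : Module.Injective A I) [Finite I] [Finite X'] [Finite Y]
    (f : I →ₗ[A] Y) (hf : Function.Injective f) :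
    Nat.card {U : Submodule A Y // LinearMap.range f ≤ U ∧
      Nonempty (U ≃ₗ[A] X' × I) ∧ Nonempty ((Y ⧸ U) ≃ₗ[A] Z)} =
    hallPair A X' Z (Y ⧸ LinearMap.range f) := by
  have : Finite (Y ⧸ LinearMap.range f) := finite_quotient _
  symm
  refine Nat.card_congr (((Submodule.comapMkQRelIso (LinearMap.range f)).toEquiv.subtypeEquiv
    fun W => ?_).trans (Equiv.subtypeSubtypeEquivSubtypeInter _
      fun U : Submodule A Y => Nonempty (U ≃ₗ[A] X' × I) ∧ Nonempty ((Y ⧸ U) ≃ₗ[A] Z)))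
  obtain ⟨e⟩ := nonempty_comap_mkQ_equiv_prod hI f hf W
  obtain ⟨q⟩ := nonempty_quotient_comap_mkQ (LinearMap.range f) W
  refine and_congr ?_ ⟨fun ⟨c⟩ => ⟨q.trans c⟩, fun ⟨c⟩ => ⟨q.symm.trans c⟩⟩
  rw [← nonempty_linearEquiv_prod_iff (P := I)]
  exact ⟨fun ⟨c⟩ => ⟨e.trans c⟩, fun ⟨c⟩ => ⟨e.symm.trans c⟩⟩

theorem hallPair_congr (e : Y ≃ₗ[A] Y') : hallPair A X Z Y = hallPair A X Z Y' := by
  refine Nat.card_congr ((Submodule.orderIsoMapComap e).toEquiv.subtypeEquiv fun U => ?_)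
  have eU : U ≃ₗ[A] U.map (e : Y →ₗ[A] Y') := e.submoduleMap U
  have eq : (Y ⧸ U) ≃ₗ[A] (Y' ⧸ U.map (e : Y →ₗ[A] Y')) := Submodule.Quotient.equiv _ _ e rfl
  exact and_congr ⟨fun ⟨c⟩ => ⟨eU.symm.trans c⟩, fun ⟨c⟩ => ⟨eU.trans c⟩⟩
    ⟨fun ⟨c⟩ => ⟨eq.symm.trans c⟩, fun ⟨c⟩ => ⟨eq.trans c⟩⟩

/-- A submodule satisfying `p` with an embedding of `I` into it is an embedding of `I` into `Y`
with a submodule satisfying `p` above its range. -/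
def sigmaMonEquiv (p : Submodule A Y → Prop) :
    (Σ U : {U : Submodule A Y // p U}, {f : I →ₗ[A] U.1 // Function.Injective f}) ≃
    (Σ f : {f : I →ₗ[A] Y // Function.Injective f},
      {U : Submodule A Y // LinearMap.range f.1 ≤ U ∧ p U}) where
  toFun x := ⟨⟨x.1.1.subtype.comp x.2.1, Subtype.val_injective.comp x.2.2⟩, x.1.1, by
    rintro _ ⟨i, rfl⟩
    exact (x.2.1 i).2, x.1.2⟩
  invFun x := ⟨⟨x.2.1, x.2.2.2⟩, x.1.1.codRestrict x.2.1 fun i => x.2.2.1 ⟨i, rfl⟩,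
    fun a b h => x.1.2 (congrArg Subtype.val h)⟩
  left_inv _ := rfl
  right_inv _ := rfl

theorem hallPair_mul_monCount (hI : Module.Injective A I) [Finite I] [Finite X'] [Finite Y]
    [Finite Y'] (e : Y ≃ₗ[A] Y' × I) :
    hallPair A (X' × I) Z Y * monCount A I (X' × I) = monCount A I Y * hallPair A X' Z Y' := by
  have : Finite (Submodule A Y) :=
    Finite.of_injective (fun K => (K : Set Y)) SetLike.coe_injective
  have : Finite (I →ₗ[A] Y) := finite_linearMap
  have : ∀ U : Submodule A Y, Finite (I →ₗ[A] U) := fun U => finite_linearMap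
  let p : Submodule A Y → Prop := fun U =>
    Nonempty (U ≃ₗ[A] X' × I) ∧ Nonempty ((Y ⧸ U) ≃ₗ[A] Z)
  have : Fintype {U : Submodule A Y // p U} := Fintype.ofFinite _
  have : Fintype {f : I →ₗ[A] Y // Function.Injective f} := Fintype.ofFinite _
  have h := Nat.card_congr (sigmaMonEquiv (I := I) p)
  rw [Nat.card_sigma, Nat.card_sigma] at h
  have hl : ∀ U : {U : Submodule A Y // p U},
      Nat.card {f : I →ₗ[A] U.1 // Function.Injective f} = monCount A I (X' × I) := fun U => by
    obtain ⟨c⟩ := U.2.1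
    exact monCount_congr_right c
  have hr : ∀ f : {f : I →ₗ[A] Y // Function.Injective f},
      Nat.card {U : Submodule A Y // LinearMap.range f.1 ≤ U ∧ p U} = hallPair A X' Z Y' :=
    fun f => by
      obtain ⟨s⟩ := nonempty_linearEquiv_prod_of_injective hI f.1 f.2 (LinearMap.range f.1).mkQ
        (Submodule.mkQ_surjective _) (Submodule.ker_mkQ _).symm
      have : Finite (Y ⧸ LinearMap.range f.1) := finite_quotient _
      obtain ⟨c⟩ := nonempty_linearEquiv_of_prod (s.symm.trans e)
      exact (card_submodule_ge_range hI f.1 f.2).trans (hallPair_congr c)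
  simp only [hl, hr, Finset.sum_const, Finset.card_univ, smul_eq_mul,
    ← Nat.card_eq_fintype_card] at h
  exact h

theorem monCount_ne_zero [Finite I] [Finite M] (f : I →ₗ[A] M) (hf : Function.Injective f) :
    monCount A I M ≠ 0 :=
  have : Finite (I →ₗ[A] M) := finite_linearMap
  have : Nonempty {f : I →ₗ[A] M // Function.Injective f} := ⟨⟨f, hf⟩⟩
  Nat.card_pos.ne'

end Splitting

end

end BirkhoffMod

/-- Lemma 3.3: for `X = X' ⊕ I` with `I` injective, `F^Y_{X,Z} ≠ 0` iff `Y ≅ Y' ⊕ I` for some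
module `Y'` with `F^{Y'}_{X',Z} ≠ 0`, and in that case
`F^Y_{X,Z} = (|Mon_A(I,Y)|/|Mon_A(I,X)|)·F^{Y'}_{X',Z}`. -/
theorem hall_number_injective_summand
    (k A : Type) [Field k] [Fintype k] [Ring A] [Algebra k A] [FiniteDimensional k A]
    (X' I Y Z : Type)
    [AddCommGroup X'] [Module A X'] [Module.Finite A X']
    [AddCommGroup I] [Module A I] [Module.Finite A I]
    [AddCommGroup Y] [Module A Y] [Module.Finite A Y]
    [AddCommGroup Z] [Module A Z] [Module.Finite A Z]
    (hI : Module.Injective A I) :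
    (BirkhoffMod.hallPair A (X' × I) Z Y ≠ 0 ↔
      ∃ Y' : ModuleCat A, Nonempty (Y ≃ₗ[A] (Y' × I)) ∧
        BirkhoffMod.hallPair A X' Z Y' ≠ 0) ∧
    (BirkhoffMod.hallPair A (X' × I) Z Y ≠ 0 →
      ∀ Y' : ModuleCat A, Nonempty (Y ≃ₗ[A] (Y' × I)) →
        (BirkhoffMod.hallPair A (X' × I) Z Y : ℚ) =
          (BirkhoffMod.monCount A I Y : ℚ) / (BirkhoffMod.monCount A I (X' × I) : ℚ) *
            (BirkhoffMod.hallPair A X' Z Y' : ℚ)) := by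
  have : Finite A := Module.finite_of_finite k
  have : Finite X' := Module.finite_of_finite A
  have : Finite I := Module.finite_of_finite A
  have : Finite Y := Module.finite_of_finite A
  have hX : BirkhoffMod.monCount A I (X' × I) ≠ 0 :=
    BirkhoffMod.monCount_ne_zero (LinearMap.inr A X' I) LinearMap.inr_injective
  have key : ∀ Y' : ModuleCat A, (Y ≃ₗ[A] (Y' × I)) →
      BirkhoffMod.hallPair A (X' × I) Z Y * BirkhoffMod.monCount A I (X' × I) =
        BirkhoffMod.monCount A I Y * BirkhoffMod.hallPair A X' Z Y' := fun Y' e => by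
    have : Finite (Y' × I) := Finite.of_equiv Y e.toEquiv
    have : Finite Y' := Finite.of_surjective (Prod.fst : Y' × I → Y') Prod.fst_surjective
    exact BirkhoffMod.hallPair_mul_monCount hI e
  refine ⟨⟨fun h => ?_, ?_⟩, ?_⟩
  · obtain ⟨⟨U, ⟨c⟩, -⟩⟩ := (Nat.card_ne_zero.1 h).1
    let f : I →ₗ[A] Y := U.subtype.comp (c.symm.toLinearMap.comp (LinearMap.inr A X' I))
    have hf : Function.Injective f :=
      Subtype.val_injective.comp (c.symm.injective.comp LinearMap.inr_injective)
    obtain ⟨s⟩ := BirkhoffMod.nonempty_linearEquiv_prod_of_injective hI f hf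
      (LinearMap.range f).mkQ (Submodule.mkQ_surjective _) (Submodule.ker_mkQ _).symm
    refine ⟨ModuleCat.of A (Y ⧸ LinearMap.range f), ⟨s⟩, fun h0 => ?_⟩
    have hmul := key (ModuleCat.of A (Y ⧸ LinearMap.range f)) s
    rw [h0, mul_zero] at hmul
    exact mul_ne_zero h hX hmul
  · rintro ⟨Y', ⟨e⟩, h⟩ h0
    have hmul := key Y' e
    rw [h0, zero_mul] at hmul
    exact mul_ne_zero (BirkhoffMod.monCount_ne_zero
      (e.symm.toLinearMap.comp (LinearMap.inr A Y' I))
      (e.symm.injective.comp LinearMap.inr_injective)) h hmul.symm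
  · rintro - Y' ⟨e⟩
    have hX' : (BirkhoffMod.monCount A I (X' × I) : ℚ) ≠ 0 := Nat.cast_ne_zero.2 hX
    rw [div_mul_eq_mul_div, eq_div_iff hX']
    exact_mod_cast key Y' e
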